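/- (Lemma: uniform concentration of Gaussian polynomials) Consider any ε > 3/n. Suppose a_i ~ N(0, I_n) i.i.d. for 1 ≤ i ≤ m, write a_{i,1} for the first entry of a_i and a_{i,⊥} ∈ ℝ^{n−1} for the remaining entries, and let S := {z ∈ ℝ^{n−1} : max_{1≤i≤m} |a_{i,⊥}^⊤ z| ≤ β‖z‖₂}, where β ≥ c₁√(log m) for a sufficiently large constant c₁ > 0. Then there is a sufficiently large constant c₀ > 0 such that with probability exceeding 1 − O(m^{−10}): (1) |(1/m) Σ_i a_{i,1}³ (a_{i,⊥}^⊤ z)| ≤ ε‖z‖₂ for all z ∈ S, provided m ≥ c₀ max{ε^{−2} n log n, ε^{−1} β n log^{5/2} m}; (2) |(1/m) Σ_i a_{i,1} (a_{i,⊥}^⊤ z)³| ≤ ε‖z‖₂³ for all z ∈ S, provided m ≥ c₀ max{ε^{−2} n log n, ε^{−1} β³ n log^{3/2} m}; (3) |(1/m) Σ_i a_{i,1}² (a_{i,⊥}^⊤ z)² − ‖z‖₂²| ≤ ε‖z‖₂² for all z ∈ S, provided m ≥ c₀ max{ε^{−2} n log n, ε^{−1} β² n log² m}; (4) |(1/m)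 Σ_i a_{i,1}⁶ (a_{i,⊥}^⊤ z)² − 15‖z‖₂²| ≤ ε‖z‖₂² for all z ∈ S, provided m ≥ c₀ max{ε^{−2} n log n, ε^{−1} β² n log⁴ m}; (5) |(1/m) Σ_i a_{i,1}² (a_{i,⊥}^⊤ z)⁶ − 15‖z‖₂⁶| ≤ ε‖z‖₂⁶ for all z ∈ S, provided m ≥ c₀ max{ε^{−2} n log n, ε^{−1} β⁶ n log² m}; (6) |(1/m) Σ_i a_{i,1}² (a_{i,⊥}^⊤ z)⁴ − 3‖z‖₂⁴| ≤ ε‖z‖₂⁴ for all z ∈ S, provided m ≥ c₀ max{ε^{−2} n log n, ε^{−1} β⁴ n log² m}. -/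

import Mathlib

open MeasureTheory ProbabilityTheory Finset

noncomputable section

namespace PR

/-- Euclidean (ℓ²) norm on `Fin N → ℝ`. -/
def nrm {N : ℕ} (x : Fin N → ℝ) : ℝ := Real.sqrt (∑ j, x j ^ 2)

/-- Euclidean inner product on `Fin N → ℝ`. -/
def dotp {N : ℕ} (x y : Fin N → ℝ) : ℝ := ∑ j, x j * y j

/-- Standard Gaussian `N(0, I_N)` on `ℝ^N`, realized as i.i.d. standard normal coordinates. -/
def stdGaussian (N : ℕ) : Measure (Fin N → ℝ) := Measure.pi fun _ => gaussianReal 0 1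

/-- Law of `m` i.i.d. `N(0, I_N)` design vectors. -/
def design (m N : ℕ) : Measure (Fin m → Fin N → ℝ) := Measure.pi fun _ => stdGaussian N

/-- Gradient of the empirical loss `f_S(x) = (1/(4m)) ∑_{i ∈ S} [(aᵢᵀx)² − (aᵢᵀx♮)²]²`,
restricted to the samples in `S`. -/
def grad {m N : ℕ} (S : Finset (Fin m)) (a : Fin m → Fin N → ℝ) (xs x : Fin N → ℝ) :
    Fin N → ℝ :=
  (m : ℝ)⁻¹ • ∑ i ∈ S, ((dotp (a i) x ^ 2 - dotp (a i) xs ^ 2) * dotp (a i) x) • a i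

/-- Gradient descent iterates with constant stepsize `η`, started at `x0`, using samples in `S`. -/
def iter {m N : ℕ} (S : Finset (Fin m)) (a : Fin m → Fin N → ℝ) (xs : Fin N → ℝ) (η : ℝ)
    (x0 : Fin N → ℝ) : ℕ → Fin N → ℝ
  | 0 => x0
  | t + 1 => iter S a xs η x0 t - η • grad S a xs (iter S a xs η x0 t)

/-- Distance modulo the global sign ambiguity. -/
def pdist {N : ℕ} (x z : Fin N → ℝ) : ℝ := min (nrm (x - z)) (nrm (x + z))

end PR

/-- The last `k` coordinates `a_⊥` of a vector `a ∈ ℝ^{k+1}`. -/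
def PR.tl {k : ℕ} (x : Fin (k + 1) → ℝ) : Fin k → ℝ := fun j => x j.succ

namespace PR

local notation "γ" => gaussianReal 0 1

lemma integrable_gaussian_iff (f : ℝ → ℝ) :
    Integrable f γ ↔ Integrable (fun x => Real.exp (-x ^ 2 / 2) * f x) := by
  rw [gaussianReal_of_var_ne_zero 0 one_ne_zero, gaussianPDF_def,
    integrable_withDensity_iff_integrable_smul₀' (by fun_prop) (by simp)]
  have h : (√(2 * Real.pi * ((1 : NNReal) : ℝ)))⁻¹ ≠ 0 := by positivity
  rw [← integrable_const_mul_iff (isUnit_iff_ne_zero.2 h) (fun x => Real.exp (-x ^ 2 / 2) * f x)]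
  refine integrable_congr (ae_of_all _ fun x => ?_)
  simp only [smul_eq_mul]
  rw [ENNReal.toReal_ofReal (gaussianPDFReal_nonneg _ _ _), gaussianPDFReal]
  simp
  ring

lemma integral_gaussian_eq (f : ℝ → ℝ) :
    ∫ x, f x ∂γ = (√(2 * Real.pi))⁻¹ * ∫ x, Real.exp (-x ^ 2 / 2) * f x := by
  rw [integral_gaussianReal_eq_integral_smul one_ne_zero, ← integral_const_mul]
  refine integral_congr_ae (ae_of_all _ fun x => ?_)
  simp [gaussianPDFReal]
  ring

lemma integrable_pow_mul_exp_neg (q : ℕ) :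
    Integrable (fun x : ℝ => Real.exp (-x ^ 2 / 2) * x ^ q) := by
  have h := integrable_rpow_mul_exp_neg_mul_sq (b := 1 / 2) (by norm_num) (s := q)
    (by linarith [(Nat.cast_nonneg q : (0 : ℝ) ≤ q)])
  refine h.congr (ae_of_all _ fun x => ?_)
  simp only [Real.rpow_natCast]
  rw [mul_comm]
  congr 2
  ring

lemma integrable_pow_gaussian (q : ℕ) : Integrable (fun x : ℝ => x ^ q) γ :=
  (integrable_gaussian_iff _).2 (integrable_pow_mul_exp_neg q)

/-- The `q`-th moment of the standard Gaussian. -/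
def moment (q : ℕ) : ℝ := ∫ x, x ^ q ∂γ

lemma moment_zero : moment 0 = 1 := by simp [moment]

lemma moment_one : moment 1 = 0 := by
  simp [moment]

lemma moment_add_two (q : ℕ) : moment (q + 2) = (q + 1) * moment q := by
  have hd : ∀ x : ℝ, HasDerivAt (fun x : ℝ => Real.exp (-x ^ 2 / 2) * x ^ (q + 1))
      ((q + 1) * (Real.exp (-x ^ 2 / 2) * x ^ q) - Real.exp (-x ^ 2 / 2) * x ^ (q + 2)) x := by
    intro x
    have h1 : HasDerivAt (fun x : ℝ => -x ^ 2 / 2) (-x) x := by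
      have := ((hasDerivAt_pow 2 x).neg).div_const 2
      convert! this using 1
      norm_num
      ring
    convert! h1.exp.mul (hasDerivAt_pow (q + 1) x) using 1
    push_cast
    ring
  have h := integral_eq_zero_of_hasDerivAt_of_integrable hd
    (((integrable_pow_mul_exp_neg q).const_mul _).sub (integrable_pow_mul_exp_neg (q + 2)))
    (integrable_pow_mul_exp_neg (q + 1))
  rw [integral_sub ((integrable_pow_mul_exp_neg q).const_mul _)
    (integrable_pow_mul_exp_neg (q + 2)), integral_const_mul] at h
  simp only [moment, integral_gaussian_eq]
  linear_combination (-(√(2 * Real.pi))⁻¹) * h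

lemma integrable_abs_pow_mul_exp (q : ℕ) :
    Integrable (fun x : ℝ => |x| ^ q * Real.exp (x ^ 2 / 4)) γ := by
  rw [integrable_gaussian_iff]
  have h := (integrable_rpow_mul_exp_neg_mul_sq (b := 1 / 4) (by norm_num) (s := q)
    (by linarith [(Nat.cast_nonneg q : (0 : ℝ) ≤ q)])).norm
  refine h.congr (ae_of_all _ fun x => ?_)
  simp only [Real.rpow_natCast, norm_mul, norm_pow, Real.norm_eq_abs, Real.abs_exp]
  rw [mul_left_comm, ← Real.exp_add]
  congr 2
  ring

/-- Exponentially weighted absolute moments of the standard Gaussian. -/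
def expMoment (q : ℕ) : ℝ := ∫ x, |x| ^ q * Real.exp (x ^ 2 / 4) ∂γ

lemma expMoment_nonneg (q : ℕ) : 0 ≤ expMoment q :=
  integral_nonneg fun x => by positivity

/-- Truncation of a real number to the interval `[-B, B]`. -/
def clip (B x : ℝ) : ℝ := max (-B) (min B x)

lemma clip_eq {B x : ℝ} (h : |x| ≤ B) : clip B x = x := by
  rw [abs_le] at h
  rw [clip, min_eq_right h.2, max_eq_right h.1]

lemma abs_clip_le {B : ℝ} (hB : 0 ≤ B) (x : ℝ) : |clip B x| ≤ B := by
  rw [clip, abs_le]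
  exact ⟨le_max_left _ _, max_le (by linarith) (min_le_left _ _)⟩

lemma abs_clip_le_abs {B : ℝ} (hB : 0 ≤ B) (x : ℝ) : |clip B x| ≤ |x| := by
  rcases le_total |x| B with h | h
  · rw [clip_eq h]
  · exact (abs_clip_le hB x).trans h

lemma abs_clip_sub_clip_le (B x y : ℝ) : |clip B x - clip B y| ≤ |x - y| := by
  unfold clip
  refine (abs_max_sub_max_le_max _ _ _ _).trans ?_
  refine max_le (by simp) ((abs_min_sub_min_le_max _ _ _ _).trans ?_)
  simp

lemma measurable_clip (B : ℝ) : Measurable (clip B) := by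
  unfold clip
  fun_prop

lemma abs_pow_sub_pow_le {B x y : ℝ} (hx : |x| ≤ B) (hy : |y| ≤ B) (p : ℕ) :
    |x ^ (p + 1) - y ^ (p + 1)| ≤ (p + 1) * B ^ p * |x - y| := by
  have hB : 0 ≤ B := (abs_nonneg x).trans hx
  induction p with
  | zero => simp
  | succ p ih =>
    have : x ^ (p + 1 + 1) - y ^ (p + 1 + 1)
        = x * (x ^ (p + 1) - y ^ (p + 1)) + (x - y) * y ^ (p + 1) := by ring
    rw [this]
    refine (abs_add_le _ _).trans ?_
    rw [abs_mul, abs_mul, abs_pow]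
    have h1 : |x| * |x ^ (p + 1) - y ^ (p + 1)| ≤ B * ((p + 1) * B ^ p * |x - y|) := by gcongr
    have h2 : |x - y| * |y| ^ (p + 1) ≤ |x - y| * B ^ (p + 1) := by gcongr
    push_cast
    calc _ ≤ _ := add_le_add h1 h2
      _ = _ := by ring

lemma integrable_clip_pow {B : ℝ} (hB : 0 ≤ B) (q : ℕ) :
    Integrable (fun x => clip B x ^ q) γ := by
  refine (integrable_pow_gaussian q).mono ((measurable_clip B).pow_const q).aestronglyMeasurable
    (ae_of_all _ fun x => ?_)
  simp only [norm_pow, Real.norm_eq_abs]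
  refine pow_le_pow_left₀ (abs_nonneg _) ?_ q
  exact abs_clip_le_abs hB x

lemma abs_integral_clip_sub_moment_le {B : ℝ} (hB : 0 ≤ B) (q : ℕ) :
    |∫ x, clip B x ^ q ∂γ - moment q| ≤ 2 * expMoment q * Real.exp (-B ^ 2 / 4) := by
  rw [moment, ← integral_sub (integrable_clip_pow hB q) (integrable_pow_gaussian q)]
  have hi := (integrable_abs_pow_mul_exp q).const_mul (2 * Real.exp (-B ^ 2 / 4))
  calc |∫ x, (clip B x ^ q - x ^ q) ∂γ|
      ≤ ∫ x, 2 * Real.exp (-B ^ 2 / 4) * (|x| ^ q * Real.exp (x ^ 2 / 4)) ∂γ := by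
        rw [← Real.norm_eq_abs]
        refine norm_integral_le_of_norm_le hi (ae_of_all _ fun x => ?_)
        rw [Real.norm_eq_abs]
        rcases le_or_gt |x| B with h | h
        · rw [clip_eq h, sub_self, abs_zero]
          positivity
        · have h1 : |clip B x ^ q - x ^ q| ≤ 2 * |x| ^ q := by
            refine (abs_sub _ _).trans ?_
            rw [abs_pow, abs_pow, two_mul]
            exact add_le_add (pow_le_pow_left₀ (abs_nonneg _) (abs_clip_le_abs hB x) q) le_rfl
          have h2 : 1 ≤ Real.exp (-B ^ 2 / 4) * Real.exp (x ^ 2 / 4) := by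
            rw [← Real.exp_add]
            apply Real.one_le_exp
            have : B ^ 2 ≤ x ^ 2 := by rw [← sq_abs x]; gcongr
            linarith
          calc _ ≤ 2 * |x| ^ q * 1 := by linarith
            _ ≤ 2 * |x| ^ q * (Real.exp (-B ^ 2 / 4) * Real.exp (x ^ 2 / 4)) := by gcongr
            _ = _ := by ring
    _ = _ := by rw [integral_const_mul, expMoment]; ring

lemma gaussian_tail {B : ℝ} (hB : 0 ≤ B) :
    (γ : Measure ℝ).real {x | B < |x|} ≤ expMoment 0 * Real.exp (-B ^ 2 / 4) := by
  have h := mul_meas_ge_le_integral_of_nonneg (μ := (γ : Measure ℝ))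
    (f := fun x => |x| ^ 0 * Real.exp (x ^ 2 / 4)) (ae_of_all _ fun x => by positivity)
    (integrable_abs_pow_mul_exp 0) (Real.exp (B ^ 2 / 4))
  have hsub : (γ : Measure ℝ).real {x | B < |x|} ≤
      (γ : Measure ℝ).real {x | Real.exp (B ^ 2 / 4) ≤ |x| ^ 0 * Real.exp (x ^ 2 / 4)} := by
    refine measureReal_mono fun x (hx : B < |x|) => ?_
    simp only [pow_zero, one_mul, Set.mem_ofPred_eq, Real.exp_le_exp]
    have : B ^ 2 ≤ x ^ 2 := by rw [← sq_abs x]; gcongr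
    linarith
  rw [neg_div, Real.exp_neg, ← div_eq_mul_inv, le_div_iff₀ (Real.exp_pos _), mul_comm]
  exact (mul_le_mul_of_nonneg_left hsub (Real.exp_pos _).le).trans h

lemma integral_exp_le_of_bounded {E : Type*} [MeasurableSpace E] {ν : Measure E}
    [IsProbabilityMeasure ν] {f : E → ℝ} (hf : Measurable f) {M V l : ℝ}
    (hM : ∀ x, |f x| ≤ M) (hV : ∫ x, f x ^ 2 ∂ν ≤ V) (hl : 0 ≤ l) (hlM : l * M ≤ 1) :
    ∫ x, Real.exp (l * f x) ∂ν ≤ Real.exp (l * ∫ x, f x ∂ν + l ^ 2 * V) := by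
  have hfi : Integrable f ν := Integrable.of_bound hf.aestronglyMeasurable M (ae_of_all _ hM)
  have hf2 : Integrable (fun x => f x ^ 2) ν :=
    Integrable.of_bound (hf.pow_const 2).aestronglyMeasurable (M ^ 2) (ae_of_all _ fun x => by
      rw [norm_pow]
      exact pow_le_pow_left₀ (norm_nonneg _) (hM x) 2)
  have hb : ∀ x, |l * f x| ≤ 1 := fun x => by
    rw [abs_mul, abs_of_nonneg hl]
    exact (mul_le_mul_of_nonneg_left (hM x) hl).trans hlM
  have hi : Integrable (fun x => 1 + l * f x + l ^ 2 * f x ^ 2) ν :=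
    ((integrable_const _).add (hfi.const_mul l)).add (hf2.const_mul _)
  calc ∫ x, Real.exp (l * f x) ∂ν ≤ ∫ x, (1 + l * f x + l ^ 2 * f x ^ 2) ∂ν := by
        refine integral_mono_of_nonneg (ae_of_all _ fun x => (Real.exp_pos _).le) hi
          (ae_of_all _ fun x => ?_)
        have := (abs_le.1 (Real.abs_exp_sub_one_sub_id_le (hb x))).2
        simp only
        nlinarith
    _ = 1 + l * ∫ x, f x ∂ν + l ^ 2 * ∫ x, f x ^ 2 ∂ν := by
        have h1 : Integrable (fun x => 1 + l * f x) ν := (integrable_const _).add (hfi.const_mul l)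
        rw [integral_add h1 (hf2.const_mul _),
          integral_add (integrable_const _) (hfi.const_mul l), integral_const_mul,
          integral_const_mul]
        simp
    _ ≤ (l * ∫ x, f x ∂ν + l ^ 2 * V) + 1 := by
        have := mul_le_mul_of_nonneg_left hV (sq_nonneg l)
        linarith
    _ ≤ _ := Real.add_one_le_exp _

lemma bernstein_upper {E : Type*} [MeasurableSpace E] {ν : Measure E}
    [IsProbabilityMeasure ν] {f : E → ℝ} (hf : Measurable f) {M V t R : ℝ} (m : ℕ)
    (hM0 : 0 < M) (hV0 : 0 < V) (ht : 0 ≤ t)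
    (hM : ∀ x, |f x| ≤ M) (hV : ∫ x, f x ^ 2 ∂ν ≤ V)
    (hR1 : R ≤ m * t ^ 2 / (4 * V)) (hR2 : R ≤ m * t / (2 * M)) :
    (Measure.pi fun _ : Fin m => ν).real {a | m * (∫ x, f x ∂ν + t) ≤ ∑ i, f (a i)}
      ≤ Real.exp (-R) := by
  obtain ⟨l, hl, hlM, hlR⟩ : ∃ l : ℝ, 0 ≤ l ∧ l * M ≤ 1 ∧ m * (l ^ 2 * V - l * t) ≤ -R := by
    rcases le_total (t * M) (2 * V) with h | h
    · refine ⟨t / (2 * V), by positivity, ?_, ?_⟩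
      · rw [div_mul_eq_mul_div, div_le_one (by positivity)]
        exact h
      · have : m * ((t / (2 * V)) ^ 2 * V - t / (2 * V) * t) = -(m * t ^ 2 / (4 * V)) := by
          field_simp
          ring
        linarith
    · refine ⟨1 / M, by positivity, by field_simp; rfl, ?_⟩
      have h1 : (1 / M) ^ 2 * V - 1 / M * t ≤ -(t / (2 * M)) := by
        have : (1 / M) ^ 2 * V - 1 / M * t = -(t / (2 * M)) + (2 * V - t * M) / (2 * M ^ 2) := by
          field_simp
          ring
        rw [this]
        have : (2 * V - t * M) / (2 * M ^ 2) ≤ 0 :=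
          div_nonpos_of_nonpos_of_nonneg (by linarith) (by positivity)
        linarith
      have := mul_le_mul_of_nonneg_left h1 (Nat.cast_nonneg (α := ℝ) m)
      have h2 : (m : ℝ) * -(t / (2 * M)) = -(m * t / (2 * M)) := by ring
      linarith
  have hprod : ∀ a : Fin m → E, Real.exp (l * ∑ i, f (a i)) = ∏ i, Real.exp (l * f (a i)) := by
    intro a
    rw [Finset.mul_sum, Real.exp_sum]
  have hbd : ∀ x, ‖Real.exp (l * f x)‖ ≤ Real.exp (l * M) := fun x => by
    rw [Real.norm_eq_abs, Real.abs_exp, Real.exp_le_exp]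
    exact mul_le_mul_of_nonneg_left ((le_abs_self _).trans (hM x)) hl
  have hint : Integrable (fun a : Fin m → E => Real.exp (l * ∑ i, f (a i)))
      (Measure.pi fun _ : Fin m => ν) := by
    simp_rw [hprod]
    exact Integrable.fintype_prod (f := fun (_ : Fin m) x => Real.exp (l * f x)) fun _ =>
      Integrable.of_bound (by fun_prop) _ (ae_of_all _ hbd)
  have hmarkov := mul_meas_ge_le_integral_of_nonneg (ae_of_all _ fun a => (Real.exp_pos _).le)
    hint (Real.exp (l * (m * (∫ x, f x ∂ν + t))))
  have hsub : (Measure.pi fun _ : Fin m => ν).real {a | m * (∫ x, f x ∂ν + t) ≤ ∑ i, f (a i)} ≤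
      (Measure.pi fun _ : Fin m => ν).real {a | Real.exp (l * (m * (∫ x, f x ∂ν + t))) ≤
        Real.exp (l * ∑ i, f (a i))} := by
    refine measureReal_mono (Set.ofPred_subset_ofPred.2 fun a ha => ?_)
    exact Real.exp_le_exp.2 (mul_le_mul_of_nonneg_left ha hl)
  have hval : ∫ a, Real.exp (l * ∑ i, f (a i)) ∂(Measure.pi fun _ : Fin m => ν) ≤
      Real.exp (m * (l * ∫ x, f x ∂ν + l ^ 2 * V)) := by
    simp_rw [hprod]
    rw [integral_fintype_prod_eq_prod (fun (_ : Fin m) x => Real.exp (l * f x))]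
    rw [Finset.prod_const, Finset.card_univ, Fintype.card_fin, Real.exp_nat_mul]
    exact pow_le_pow_left₀ (integral_nonneg fun x => (Real.exp_pos _).le)
      (integral_exp_le_of_bounded hf hM hV hl hlM) m
  have h3 := (mul_le_mul_of_nonneg_left hsub (Real.exp_pos _).le).trans (hmarkov.trans hval)
  rw [mul_comm, ← le_div_iff₀ (Real.exp_pos _), ← Real.exp_sub] at h3
  refine h3.trans (Real.exp_le_exp.2 ?_)
  linarith

/-- Bernstein's inequality for the empirical mean of a bounded function. -/
lemma bernstein {E : Type*} [MeasurableSpace E] {ν : Measure E}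
    [IsProbabilityMeasure ν] {f : E → ℝ} (hf : Measurable f) {M V t R : ℝ} {m : ℕ} (hm : 0 < m)
    (hM0 : 0 < M) (hV0 : 0 < V) (ht : 0 ≤ t)
    (hM : ∀ x, |f x| ≤ M) (hV : ∫ x, f x ^ 2 ∂ν ≤ V)
    (hR1 : R ≤ m * t ^ 2 / (4 * V)) (hR2 : R ≤ m * t / (2 * M)) :
    (Measure.pi fun _ : Fin m => ν).real {a | t < |(m : ℝ)⁻¹ * ∑ i, f (a i) - ∫ x, f x ∂ν|}
      ≤ 2 * Real.exp (-R) := by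
  have h1 := bernstein_upper (ν := ν) hf m hM0 hV0 ht hM hV hR1 hR2
  have h2 := bernstein_upper (ν := ν) (f := fun x => -f x) hf.neg m hM0 hV0 ht
    (by simpa using hM) (by simpa using hV) hR1 hR2
  have hm' : (0 : ℝ) < m := by exact_mod_cast hm
  refine (measureReal_mono ?_).trans ((measureReal_union_le _ _).trans (add_le_add h1 h2) |>.trans
    (by linarith))
  intro a ha
  rw [Set.mem_ofPred_eq] at ha
  rcases lt_abs.1 ha with h | h
  · left
    rw [Set.mem_ofPred_eq]
    have : (m : ℝ) * (∫ x, f x ∂ν + t) < m * ((m : ℝ)⁻¹ * ∑ i, f (a i)) :=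
      mul_lt_mul_of_pos_left (by linarith) hm'
    rw [mul_inv_cancel_left₀ hm'.ne'] at this
    exact this.le
  · right
    rw [Set.mem_ofPred_eq]
    rw [integral_neg, Finset.sum_neg_distrib]
    have : (m : ℝ) * ((m : ℝ)⁻¹ * ∑ i, f (a i)) < m * (∫ x, f x ∂ν - t) :=
      mul_lt_mul_of_pos_left (by linarith) hm'
    rw [mul_inv_cancel_left₀ hm'.ne'] at this
    linarith

instance (n : ℕ) : IsProbabilityMeasure (PR.stdGaussian n) := by
  unfold PR.stdGaussian; infer_instance

instance (m n : ℕ) : IsProbabilityMeasure (PR.design m n) := by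
  unfold PR.design; infer_instance

lemma nrm_sq {k : ℕ} (z : Fin k → ℝ) : nrm z ^ 2 = ∑ j, z j ^ 2 :=
  Real.sq_sqrt (Finset.sum_nonneg fun _ _ => sq_nonneg _)

lemma nrm_nonneg {k : ℕ} (z : Fin k → ℝ) : 0 ≤ nrm z := Real.sqrt_nonneg _

lemma measurable_dotp {k : ℕ} (z : Fin k → ℝ) : Measurable fun w : Fin k → ℝ => dotp w z := by
  unfold dotp
  fun_prop

lemma map_dotp_stdGaussian {k : ℕ} {z : Fin k → ℝ} (hz : nrm z = 1) :
    (PR.stdGaussian k).map (fun w => dotp w z) = γ := by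
  have : IsProbabilityMeasure ((PR.stdGaussian k).map (fun w => dotp w z)) :=
    Measure.isProbabilityMeasure_map (measurable_dotp z).aemeasurable
  refine Measure.ext_of_charFun (funext fun t => ?_)
  rw [charFun_gaussianReal, charFun_apply_real,
    integral_map (measurable_dotp z).aemeasurable (by fun_prop), PR.stdGaussian]
  have h1 : ∀ w : Fin k → ℝ, Complex.exp (t * (dotp w z : ℝ) * Complex.I) =
      ∏ j, Complex.exp (((t * z j : ℝ) : ℂ) * (w j : ℝ) * Complex.I) := by
    intro w
    rw [← Complex.exp_sum, dotp]
    congr 1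
    push_cast
    rw [Finset.mul_sum, Finset.sum_mul]
    exact Finset.sum_congr rfl fun j _ => by ring
  simp_rw [h1]
  rw [integral_fintype_prod_eq_prod
    (fun (j : Fin k) (x : ℝ) => Complex.exp (((t * z j : ℝ) : ℂ) * (x : ℝ) * Complex.I))]
  simp_rw [← charFun_apply_real, charFun_gaussianReal]
  rw [← Complex.exp_sum]
  congr 1
  have h2 : ((∑ j, z j ^ 2 : ℝ) : ℂ) = 1 := by
    rw [← nrm_sq, hz]; simp
  push_cast at h2
  simp only [Complex.ofReal_zero, mul_zero, zero_mul, zero_sub, NNReal.coe_one,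
    Complex.ofReal_one, one_mul]
  push_cast
  rw [Finset.sum_neg_distrib, ← Finset.sum_div]
  simp_rw [mul_pow]
  rw [← Finset.mul_sum, h2, mul_one]

lemma measurePreserving_head_dotp {k : ℕ} {z : Fin k → ℝ} (hz : nrm z = 1) :
    MeasurePreserving (fun x : Fin (k + 1) → ℝ => (x 0, dotp (tl x) z))
      (PR.stdGaussian (k + 1)) ((γ : Measure ℝ).prod γ) := by
  have h1 := measurePreserving_piFinSuccAbove (fun _ : Fin (k + 1) => (γ : Measure ℝ)) 0
  have h2 : MeasurePreserving (fun w : Fin k → ℝ => dotp w z) (PR.stdGaussian k) γ :=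
    ⟨measurable_dotp z, map_dotp_stdGaussian hz⟩
  have h3 := ((MeasurePreserving.id (γ : Measure ℝ)).prod h2).comp h1
  exact h3

lemma measurable_tl {k : ℕ} : Measurable (tl : (Fin (k + 1) → ℝ) → Fin k → ℝ) := by
  unfold tl
  fun_prop

lemma design_coord_tail {m n : ℕ} (i : Fin m) (j : Fin n) {B : ℝ} (hB : 0 ≤ B) :
    (PR.design m n).real {a | B < |a i j|} ≤ expMoment 0 * Real.exp (-B ^ 2 / 4) := by
  have h1 := measurePreserving_eval (fun _ : Fin m => PR.stdGaussian n) i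
  have h2 := measurePreserving_eval (fun _ : Fin n => (γ : Measure ℝ)) j
  have h3 := h2.comp h1
  have hs : MeasurableSet {x : ℝ | B < |x|} := measurableSet_lt measurable_const measurable_norm
  have := h3.measureReal_preimage hs.nullMeasurableSet
  refine le_trans (le_of_eq ?_) (gaussian_tail hB)
  rw [← this]
  rfl

lemma abs_coord_le_one {k : ℕ} {z : Fin k → ℝ} (hz : nrm z = 1) (j : Fin k) : |z j| ≤ 1 := by
  rw [← sq_le_one_iff_abs_le_one]
  have h := nrm_sq z
  rw [hz, one_pow] at h
  rw [h]
  exact Finset.single_le_sum (f := fun j => z j ^ 2) (fun _ _ => sq_nonneg _) (Finset.mem_univ j)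

open Classical in
lemma exists_net (k : ℕ) {m : ℕ} (hm : 0 < m) :
    ∃ T : Finset (Fin k → ℝ), T.card ≤ (2 * m + 1) ^ k ∧ (∀ z ∈ T, nrm z = 1) ∧
      ∀ z : Fin k → ℝ, nrm z = 1 → ∃ z' ∈ T, ∀ j, |z j - z' j| ≤ 1 / m := by
  have hm' : (0 : ℝ) < m := by exact_mod_cast hm
  let cell : (Fin k → ℝ) → Fin k → ℤ := fun z j => ⌊m * z j⌋
  let cells : Finset (Fin k → ℤ) := Fintype.piFinset fun _ => Finset.Icc (-m : ℤ) m
  let P : (Fin k → ℤ) → Prop := fun c => ∃ z : Fin k → ℝ, nrm z = 1 ∧ cell z = c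
  let r : (Fin k → ℤ) → Fin k → ℝ := fun c => if h : P c then h.choose else 0
  have hr : ∀ c, P c → nrm (r c) = 1 ∧ cell (r c) = c := fun c h => by
    simp only [r, dif_pos h]
    exact h.choose_spec
  refine ⟨(cells.filter P).image r, ?_, ?_, ?_⟩
  · refine Finset.card_image_le.trans ((Finset.card_filter_le _ _).trans (le_of_eq ?_))
    simp only [cells, Fintype.card_piFinset, Int.card_Icc, Finset.prod_const, Finset.card_univ,
      Fintype.card_fin]
    congr 1
    omega
  · intro z hz
    obtain ⟨c, hc, rfl⟩ := Finset.mem_image.1 hz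
    exact (hr c (Finset.mem_filter.1 hc).2).1
  · intro z hz
    have hP : P (cell z) := ⟨z, hz, rfl⟩
    refine ⟨r (cell z), Finset.mem_image_of_mem _ (Finset.mem_filter.2 ⟨?_, hP⟩), fun j => ?_⟩
    · refine Fintype.mem_piFinset.2 fun j => Finset.mem_Icc.2 ?_
      have hj := abs_le.1 (abs_coord_le_one hz j)
      constructor
      · refine Int.le_floor.2 ?_
        push_cast
        nlinarith
      · refine Int.floor_le_iff.2 ?_
        push_cast
        nlinarith
    · have h := congrFun (hr _ hP).2 j
      have h2 := Int.abs_sub_lt_one_of_floor_eq_floor h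
      rw [← mul_sub, abs_mul, abs_of_pos hm', abs_sub_comm] at h2
      rw [le_div_iff₀ hm', mul_comm]
      exact h2.le

/-- The truncated polynomial `x ↦ x₁^q (x_⊥ᵀ z)^p`. -/
def truncPoly (q p : ℕ) (B β : ℝ) {k : ℕ} (z : Fin k → ℝ) (x : Fin (k + 1) → ℝ) : ℝ :=
  clip B (x 0) ^ q * clip β (dotp (tl x) z) ^ p

lemma measurable_truncPoly (q p : ℕ) (B β : ℝ) {k : ℕ} (z : Fin k → ℝ) :
    Measurable (truncPoly q p B β z) :=
  (((measurable_clip B).comp (measurable_pi_apply 0)).pow_const q).mul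
    (((measurable_clip β).comp ((measurable_dotp z).comp measurable_tl)).pow_const p)

lemma abs_truncPoly_le (q p : ℕ) {B β : ℝ} (hB : 0 ≤ B) (hβ : 0 ≤ β) {k : ℕ} (z : Fin k → ℝ)
    (x : Fin (k + 1) → ℝ) : |truncPoly q p B β z x| ≤ B ^ q * β ^ p := by
  rw [truncPoly, abs_mul, abs_pow, abs_pow]
  exact mul_le_mul (pow_le_pow_left₀ (abs_nonneg _) (abs_clip_le hB _) q)
    (pow_le_pow_left₀ (abs_nonneg _) (abs_clip_le hβ _) p) (by positivity) (by positivity)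

lemma integral_mul_head_dotp {k : ℕ} {z : Fin k → ℝ} (hz : nrm z = 1) {f g : ℝ → ℝ}
    (hf : Measurable f) (hg : Measurable g) :
    ∫ x, f (x 0) * g (dotp (tl x) z) ∂(PR.stdGaussian (k + 1)) =
      (∫ x, f x ∂γ) * ∫ x, g x ∂γ := by
  have hp := measurePreserving_head_dotp hz
  rw [← integral_prod_mul, ← hp.map_eq, integral_map hp.measurable.aemeasurable]
  exact ((hf.comp measurable_fst).mul (hg.comp measurable_snd)).aestronglyMeasurable

lemma integral_truncPoly (q p : ℕ) (B β : ℝ) {k : ℕ} {z : Fin k → ℝ} (hz : nrm z = 1) :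
    ∫ x, truncPoly q p B β z x ∂(PR.stdGaussian (k + 1)) =
      (∫ x, clip B x ^ q ∂γ) * ∫ x, clip β x ^ p ∂γ :=
  integral_mul_head_dotp hz (f := fun x => clip B x ^ q) (g := fun x => clip β x ^ p)
    ((measurable_clip B).pow_const q) ((measurable_clip β).pow_const p)

lemma moment_two_mul_nonneg (q : ℕ) : 0 ≤ moment (2 * q) :=
  integral_nonneg fun x => (even_two_mul q).pow_nonneg x

lemma integral_clip_pow_sq_le {B : ℝ} (hB : 0 ≤ B) (q : ℕ) :
    ∫ x, (clip B x ^ q) ^ 2 ∂γ ≤ moment (2 * q) := by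
  refine integral_mono_of_nonneg (ae_of_all _ fun x => by positivity)
    (integrable_pow_gaussian (2 * q)) (ae_of_all _ fun x => ?_)
  simp only
  rw [← pow_mul, mul_comm q 2, pow_mul, pow_mul, ← sq_abs, ← sq_abs x]
  exact pow_le_pow_left₀ (by positivity)
    (pow_le_pow_left₀ (abs_nonneg _) (abs_clip_le_abs hB x) 2) q

lemma integral_truncPoly_sq_le (q p : ℕ) {B β : ℝ} (hB : 0 ≤ B) (hβ : 0 ≤ β) {k : ℕ}
    {z : Fin k → ℝ} (hz : nrm z = 1) :
    ∫ x, truncPoly q p B β z x ^ 2 ∂(PR.stdGaussian (k + 1)) ≤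
      moment (2 * q) * moment (2 * p) := by
  simp_rw [truncPoly, mul_pow]
  rw [integral_mul_head_dotp hz (f := fun x => (clip B x ^ q) ^ 2)
    (g := fun x => (clip β x ^ p) ^ 2) (((measurable_clip B).pow_const q).pow_const 2)
    (((measurable_clip β).pow_const p).pow_const 2)]
  exact mul_le_mul (integral_clip_pow_sq_le hB q) (integral_clip_pow_sq_le hβ p)
    (integral_nonneg fun x => by positivity) (moment_two_mul_nonneg q)

/-- A constant controlling the bias caused by truncation. -/
def biasConst (q p : ℕ) : ℝ :=
  (|moment q| + 2 * expMoment q) * (2 * expMoment p) + 2 * expMoment q * |moment p|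

lemma biasConst_nonneg (q p : ℕ) : 0 ≤ biasConst q p := by
  have h1 := expMoment_nonneg q
  have h2 := expMoment_nonneg p
  unfold biasConst
  positivity

lemma truncation_bias_le (q p : ℕ) {B β : ℝ} (hB : 0 ≤ B) (hβ : B ≤ β) :
    |(∫ x, clip B x ^ q ∂γ) * (∫ x, clip β x ^ p ∂γ) - moment q * moment p| ≤
      biasConst q p * Real.exp (-B ^ 2 / 4) := by
  have h1 := abs_integral_clip_sub_moment_le hB q
  have h2 := abs_integral_clip_sub_moment_le (hB.trans hβ) p
  set A := ∫ x, clip B x ^ q ∂γ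
  set D := ∫ x, clip β x ^ p ∂γ
  have hq := expMoment_nonneg q
  have hp := expMoment_nonneg p
  have he : Real.exp (-B ^ 2 / 4) ≤ 1 := Real.exp_le_one_iff.2 (by nlinarith [sq_nonneg B])
  have h2' : |D - moment p| ≤ 2 * expMoment p * Real.exp (-B ^ 2 / 4) := by
    refine h2.trans ?_
    gcongr
  have hA : |A| ≤ |moment q| + 2 * expMoment q := by
    have h3 : |A| ≤ |moment q| + |A - moment q| := by
      simpa using abs_add_le (moment q) (A - moment q)
    nlinarith
  have : A * D - moment q * moment p = A * (D - moment p) + (A - moment q) * moment p := by ring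
  rw [this]
  refine (abs_add_le _ _).trans ?_
  rw [abs_mul, abs_mul, biasConst, add_mul]
  refine add_le_add ?_ ?_
  · rw [mul_assoc (_ + _)]
    exact mul_le_mul hA h2' (abs_nonneg _) (by positivity)
  · rw [mul_right_comm]
    exact mul_le_mul_of_nonneg_right h1 (abs_nonneg _)

lemma abs_dotp_sub_le {k : ℕ} {w z z' : Fin k → ℝ} {B d : ℝ} (hB : 0 ≤ B)
    (hw : ∀ j, |w j| ≤ B) (hz : ∀ j, |z j - z' j| ≤ d) :
    |dotp w z - dotp w z'| ≤ k * (B * d) := by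
  rw [dotp, dotp, ← Finset.sum_sub_distrib]
  refine (Finset.abs_sum_le_sum_abs _ _).trans ?_
  refine (Finset.sum_le_card_nsmul _ _ (B * d) fun j _ => ?_).trans (by simp)
  rw [← mul_sub, abs_mul]
  exact mul_le_mul (hw j) (hz j) (abs_nonneg _) hB

lemma abs_average_le {m : ℕ} (hm : 0 < m) {f : Fin m → ℝ} {C : ℝ} (h : ∀ i, |f i| ≤ C) :
    |(m : ℝ)⁻¹ * ∑ i, f i| ≤ C := by
  have hm' : (0 : ℝ) < m := by exact_mod_cast hm
  rw [abs_mul, abs_of_pos (inv_pos.2 hm'), inv_mul_le_iff₀ hm']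
  refine (Finset.abs_sum_le_sum_abs _ _).trans ?_
  exact (Finset.sum_le_card_nsmul _ _ C fun i _ => h i).trans (by simp)

lemma average_sub_truncPoly_le (q p : ℕ) {B β : ℝ} (hB : 0 ≤ B) (hβ : 0 ≤ β) {k m : ℕ}
    (hm : 0 < m) {d : ℝ} {z z' : Fin k → ℝ} (hz : ∀ j, |z j - z' j| ≤ d)
    {a : Fin m → Fin (k + 1) → ℝ} (ha : ∀ i j, |a i j| ≤ B)
    (hS : ∀ i, |dotp (tl (a i)) z| ≤ β) :
    |(m : ℝ)⁻¹ * ∑ i, a i 0 ^ q * dotp (tl (a i)) z ^ (p + 1) -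
      (m : ℝ)⁻¹ * ∑ i, truncPoly q (p + 1) B β z' (a i)| ≤
      B ^ q * ((p + 1) * β ^ p * (k * (B * d))) := by
  rw [← mul_sub, ← Finset.sum_sub_distrib]
  refine abs_average_le hm fun i => ?_
  rw [truncPoly, clip_eq (ha i 0), ← mul_sub, abs_mul, abs_pow]
  refine mul_le_mul (pow_le_pow_left₀ (abs_nonneg _) (ha i 0) q) ?_ (abs_nonneg _) (by positivity)
  refine (abs_pow_sub_pow_le (hS i) (abs_clip_le hβ _) p).trans ?_
  refine mul_le_mul_of_nonneg_left ?_ (by positivity)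
  calc |dotp (tl (a i)) z - clip β (dotp (tl (a i)) z')|
      = |clip β (dotp (tl (a i)) z) - clip β (dotp (tl (a i)) z')| := by rw [clip_eq (hS i)]
    _ ≤ |dotp (tl (a i)) z - dotp (tl (a i)) z'| := abs_clip_sub_clip_le _ _ _
    _ ≤ k * (B * d) := abs_dotp_sub_le hB (fun j => ha i j.succ) hz

/-- The designs for which the empirical average of `a₁^q (a_⊥ᵀ z)^p` is far from its mean
at some incoherent `z`. -/
def badSet (q p k m : ℕ) (ε β : ℝ) : Set (Fin m → Fin (k + 1) → ℝ) :=
  {a | ∃ z : Fin k → ℝ, (∀ i, |dotp (tl (a i)) z| ≤ β * nrm z) ∧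
    ε * nrm z ^ p < |(m : ℝ)⁻¹ * ∑ i, a i 0 ^ q * dotp (tl (a i)) z ^ p -
      moment q * moment p * nrm z ^ p|}

lemma nrm_eq_zero {k : ℕ} {z : Fin k → ℝ} (hz : nrm z = 0) : z = 0 := by
  have h := nrm_sq z
  rw [hz] at h
  funext j
  have := (Finset.sum_eq_zero_iff_of_nonneg (fun j _ => sq_nonneg (z j))).1
    (by rw [← h]; simp) j (Finset.mem_univ j)
  simpa using this

lemma exists_unit_of_mem_badSet {q p k m : ℕ} {ε β : ℝ} {a : Fin m → Fin (k + 1) → ℝ}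
    (ha : a ∈ badSet q (p + 1) k m ε β) :
    ∃ u : Fin k → ℝ, nrm u = 1 ∧ (∀ i, |dotp (tl (a i)) u| ≤ β) ∧
      ε < |(m : ℝ)⁻¹ * ∑ i, a i 0 ^ q * dotp (tl (a i)) u ^ (p + 1) -
        moment q * moment (p + 1)| := by
  obtain ⟨z, hS, hz⟩ := ha
  rcases (nrm_nonneg z).eq_or_lt with h0 | h0
  · exfalso
    have hz0 := nrm_eq_zero h0.symm
    rw [← h0] at hz
    simp [hz0, dotp] at hz
  · have hdot : ∀ w : Fin k → ℝ, dotp w z = nrm z * dotp w ((nrm z)⁻¹ • z) := by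
      intro w
      simp only [dotp, Finset.mul_sum, Pi.smul_apply, smul_eq_mul]
      refine Finset.sum_congr rfl fun j _ => ?_
      field_simp
    refine ⟨(nrm z)⁻¹ • z, ?_, fun i => ?_, ?_⟩
    · have h1 : nrm ((nrm z)⁻¹ • z) ^ 2 = 1 := by
        rw [nrm_sq]
        simp only [Pi.smul_apply, smul_eq_mul, mul_pow]
        rw [← Finset.mul_sum, ← nrm_sq]
        field_simp
      exact (pow_eq_one_iff_of_nonneg (nrm_nonneg _) two_ne_zero).1 h1
    · have h1 := hS i
      rw [hdot, abs_mul, abs_of_pos h0, mul_comm β] at h1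
      exact le_of_mul_le_mul_left h1 h0
    · have hpow : 0 < nrm z ^ (p + 1) := by positivity
      have h1 : (m : ℝ)⁻¹ * ∑ i, a i 0 ^ q * dotp (tl (a i)) z ^ (p + 1) -
          moment q * moment (p + 1) * nrm z ^ (p + 1) =
          nrm z ^ (p + 1) * ((m : ℝ)⁻¹ * ∑ i, a i 0 ^ q *
            dotp (tl (a i)) ((nrm z)⁻¹ • z) ^ (p + 1) - moment q * moment (p + 1)) := by
        have h2 : ∑ i, a i 0 ^ q * dotp (tl (a i)) z ^ (p + 1) = nrm z ^ (p + 1) *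
            ∑ i, a i 0 ^ q * dotp (tl (a i)) ((nrm z)⁻¹ • z) ^ (p + 1) := by
          rw [Finset.mul_sum]
          refine Finset.sum_congr rfl fun i _ => ?_
          rw [hdot (tl (a i)), mul_pow]
          ring
        rw [h2]
        ring
      rw [h1, abs_mul, abs_of_pos hpow, mul_comm ε] at hz
      exact lt_of_mul_lt_mul_left hz hpow.le

/-- A sufficiently large constant in the sample-size condition for `a₁^q (a_⊥ᵀ z)^(p + 1)`. -/
def sampleConst (q p : ℕ) : ℝ :=
  768 * (moment (2 * q) * moment (2 * (p + 1)) + 1) + 96 + 4 * (p + 1) +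
    4 * biasConst q (p + 1) + 2 * |moment q * moment (p + 1)|

lemma exp_neg_mul_log {m : ℕ} (hm : 0 < m) (r : ℕ) :
    Real.exp (-(r * Real.log m)) = ((m : ℝ) ^ r)⁻¹ := by
  rw [Real.exp_neg, Real.exp_nat_mul, Real.exp_log (by exact_mod_cast hm)]

lemma design_head_tail {m n : ℕ} (j : Fin n) {B : ℝ} (hB : 0 ≤ B) :
    (PR.design m n).real {a | ∃ i, B < |a i j|} ≤
      m * (expMoment 0 * Real.exp (-B ^ 2 / 4)) := by
  have : {a : Fin m → Fin n → ℝ | ∃ i, B < |a i j|} = ⋃ i, {a | B < |a i j|} := by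
    ext a; simp
  rw [this]
  refine (measureReal_iUnion_fintype_le _).trans ?_
  refine (Finset.sum_le_card_nsmul _ _ _ fun i _ => design_coord_tail i j hB).trans ?_
  simp

lemma design_coords_tail {m n : ℕ} {B : ℝ} (hB : 0 ≤ B) :
    (PR.design m n).real {a | ∃ i j, B < |a i j|} ≤
      n * (m * (expMoment 0 * Real.exp (-B ^ 2 / 4))) := by
  have : {a : Fin m → Fin n → ℝ | ∃ i j, B < |a i j|} = ⋃ j, {a | ∃ i, B < |a i j|} := by
    ext a; simp only [Set.mem_ofPred_eq, Set.mem_iUnion]; exact exists_comm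
  rw [this]
  refine (measureReal_iUnion_fintype_le _).trans ?_
  refine (Finset.sum_le_card_nsmul _ _ _ fun j _ => design_head_tail j hB).trans ?_
  simp

set_option maxHeartbeats 1000000 in
lemma measure_badSet_le (q p k m : ℕ) {ε B β : ℝ} (hm : 3 ≤ m) (hε : 0 < ε)
    (hB : B = 7 * √(Real.log m)) (hβ : B ≤ β)
    (h1 : sampleConst q p * ((k + 1) * Real.log m) ≤ m * ε ^ 2)
    (h2 : sampleConst q p * ((k + 1) * Real.log m * (B ^ q * β ^ (p + 1))) ≤ m * ε) :
    (PR.design m (k + 1)).real (badSet q (p + 1) k m ε β) ≤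
      (2 + expMoment 0) * ((m : ℝ) ^ 10)⁻¹ := by
  have hm0 : 0 < m := by omega
  have hmR : (3 : ℝ) ≤ m := by exact_mod_cast hm
  have hmp : (0 : ℝ) < m := by linarith
  set L := Real.log m with hL
  have hL1 : 1 ≤ L := by
    rw [hL, Real.le_log_iff_exp_le hmp]
    linarith [Real.exp_one_lt_d9]
  have hs1 : 1 ≤ √L := Real.one_le_sqrt.2 hL1
  have hB1 : 1 ≤ B := by rw [hB]; linarith
  have hB0 : 0 ≤ B := by linarith
  have hβ1 : 1 ≤ β := hB1.trans hβ
  have hβ0 : 0 ≤ β := by linarith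
  have hB2 : -B ^ 2 / 4 = -((12.25 : ℝ) * L) := by
    rw [hB, mul_pow, Real.sq_sqrt (by linarith)]
    ring
  have hexp : Real.exp (-B ^ 2 / 4) ≤ ((m : ℝ) ^ 12)⁻¹ := by
    rw [← exp_neg_mul_log hm0, hB2, Real.exp_le_exp]
    push_cast
    linarith
  have he0 := expMoment_nonneg 0
  set V := moment (2 * q) * moment (2 * (p + 1)) with hV
  have hV0 : 0 ≤ V := mul_nonneg (moment_two_mul_nonneg _) (moment_two_mul_nonneg _)
  set b := biasConst q (p + 1) with hb
  have hb0 : 0 ≤ b := biasConst_nonneg _ _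
  set μ₀ := moment q * moment (p + 1) with hμ₀
  set K := sampleConst q p with hK
  have hK' : K = 768 * (V + 1) + 96 + 4 * (p + 1) + 4 * b + 2 * |μ₀| := rfl
  have hp0 : (0 : ℝ) ≤ p := Nat.cast_nonneg p
  have hμa := abs_nonneg μ₀
  set M := B ^ q * β ^ (p + 1) with hM
  have hM1 : 1 ≤ M := one_le_mul_of_one_le_of_one_le (one_le_pow₀ hB1) (one_le_pow₀ hβ1)
  have hk0 : (0 : ℝ) ≤ k := Nat.cast_nonneg k
  have hK0 : 0 ≤ K := by rw [hK']; positivity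
  have hkL : 0 ≤ k * L := by positivity
  have hkM : (k + 1) * M ≤ (k + 1) * L * M := by
    rw [mul_right_comm]
    exact le_mul_of_one_le_right (by positivity) hL1
  have hKkM : K * ((k + 1) * M) ≤ m * ε := (mul_le_mul_of_nonneg_left hkM hK0).trans h2
  rcases le_or_gt (k + 1) m with hkm | hkm
  · obtain ⟨T, hTcard, hTunit, hT⟩ := exists_net k hm0
    set E : (Fin k → ℝ) → Set (Fin m → Fin (k + 1) → ℝ) := fun z =>
      {a | ε / 4 < |(m : ℝ)⁻¹ * ∑ i, truncPoly q (p + 1) B β z (a i) -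
        ∫ x, truncPoly q (p + 1) B β z x ∂(PR.stdGaussian (k + 1))|} with hE
    have hsub : badSet q (p + 1) k m ε β ⊆ {a | ∃ i j, B < |a i j|} ∪ ⋃ z ∈ T, E z := by
      intro a ha
      by_cases hc : ∃ i j, B < |a i j|
      · exact Or.inl hc
      right
      push Not at hc
      obtain ⟨z, hz1, hzS, hz⟩ := exists_unit_of_mem_badSet ha
      obtain ⟨z', hz'T, hz'⟩ := hT z hz1
      simp only [Set.mem_iUnion]
      refine ⟨z', hz'T, ?_⟩
      rw [hE, Set.mem_ofPred_eq]
      have e1 := average_sub_truncPoly_le q p hB0 hβ0 hm0 hz' hc hzS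
      have e2 := truncation_bias_le q (p + 1) hB0 hβ
      rw [← integral_truncPoly q (p + 1) B β (hTunit z' hz'T), ← hb, ← hμ₀] at e2
      have e3 : B ^ q * ((p + 1) * β ^ p * (k * (B * (1 / m)))) ≤ ε / 4 := by
        calc B ^ q * ((p + 1) * β ^ p * (k * (B * (1 / m))))
            ≤ B ^ q * ((p + 1) * β ^ p * ((k + 1) * (β * (1 / m)))) := by
              gcongr
              linarith
          _ = (p + 1) * ((k + 1) * M) / m := by rw [hM]; ring
          _ ≤ ε / 4 := by
              rw [div_le_iff₀ hmp]
              have : 4 * ((p : ℝ) + 1) * ((k + 1) * M) ≤ K * ((k + 1) * M) := by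
                refine mul_le_mul_of_nonneg_right ?_ (by positivity)
                rw [hK']; linarith
              linarith
      have e4 : b * Real.exp (-B ^ 2 / 4) ≤ ε / 4 := by
        have h3 : Real.exp (-B ^ 2 / 4) ≤ (m : ℝ)⁻¹ := hexp.trans
          (inv_anti₀ hmp (le_self_pow₀ (by linarith) (by norm_num)))
        have h4 : b * (m : ℝ)⁻¹ ≤ ε / 4 := by
          rw [← div_eq_mul_inv, div_le_iff₀ hmp]
          have h5 : K * 1 ≤ K * ((k + 1) * M) :=
            mul_le_mul_of_nonneg_left (one_le_mul_of_one_le_of_one_le (by linarith) hM1) hK0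
          have h6 : 4 * b ≤ K := by rw [hK']; linarith
          linarith
        exact (mul_le_mul_of_nonneg_left h3 hb0).trans h4
      by_contra! hcon
      have t1 := abs_sub_le ((m : ℝ)⁻¹ * ∑ i, a i 0 ^ q * dotp (tl (a i)) z ^ (p + 1))
        ((m : ℝ)⁻¹ * ∑ i, truncPoly q (p + 1) B β z' (a i)) μ₀
      have t2 := abs_sub_le ((m : ℝ)⁻¹ * ∑ i, truncPoly q (p + 1) B β z' (a i))
        (∫ x, truncPoly q (p + 1) B β z' x ∂(PR.stdGaussian (k + 1))) μ₀
      linarith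
    have hEz : ∀ z ∈ T, (PR.design m (k + 1)).real (E z) ≤
        2 * Real.exp (-(12 * ((k + 1) * L))) := by
      intro z hz
      refine bernstein (ν := PR.stdGaussian (k + 1)) (V := V + 1) (M := M)
        (measurable_truncPoly q (p + 1) B β z) hm0 (by linarith) (by linarith) (by linarith)
        (abs_truncPoly_le q (p + 1) hB0 hβ0 z)
        ((integral_truncPoly_sq_le q (p + 1) hB0 hβ0 (hTunit z hz)).trans (by linarith)) ?_ ?_
      · rw [le_div_iff₀ (by linarith)]
        have : 768 * (V + 1) * ((k + 1) * L) ≤ K * ((k + 1) * L) := by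
          refine mul_le_mul_of_nonneg_right ?_ (by positivity)
          rw [hK']; linarith
        linarith
      · rw [le_div_iff₀ (by linarith)]
        have : 96 * ((k + 1) * L * M) ≤ K * ((k + 1) * L * M) := by
          refine mul_le_mul_of_nonneg_right ?_ (by positivity)
          rw [hK']; linarith
        linarith
    have hcard : (T.card : ℝ) ≤ Real.exp (2 * ((k + 1) * L)) := by
      have h3 : (T.card : ℝ) ≤ ((2 * m + 1 : ℕ) : ℝ) ^ k := by exact_mod_cast hTcard
      have h4 : ((2 * m + 1 : ℕ) : ℝ) ≤ (m : ℝ) ^ 2 := by push_cast; nlinarith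
      refine h3.trans ((pow_le_pow_left₀ (by positivity) h4 k).trans ?_)
      have h5 : (m : ℝ) ^ 2 = Real.exp (2 * L) := by
        rw [hL, ← Real.exp_log hmp, ← Real.exp_nat_mul, Real.exp_log hmp]
        norm_num
      rw [h5, ← Real.exp_nat_mul, Real.exp_le_exp]
      linarith
    have hU : (PR.design m (k + 1)).real (⋃ z ∈ T, E z) ≤ 2 * ((m : ℝ) ^ 10)⁻¹ := by
      refine (measureReal_biUnion_finset_le T E).trans
        ((Finset.sum_le_card_nsmul T _ _ hEz).trans ?_)
      rw [nsmul_eq_mul]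
      calc (T.card : ℝ) * (2 * Real.exp (-(12 * ((k + 1) * L))))
          ≤ Real.exp (2 * ((k + 1) * L)) * (2 * Real.exp (-(12 * ((k + 1) * L)))) := by gcongr
        _ = 2 * Real.exp (-(10 * ((k + 1) * L))) := by
            rw [mul_left_comm, ← Real.exp_add]
            ring_nf
        _ ≤ 2 * Real.exp (-((10 : ℕ) * L)) := by
            refine mul_le_mul_of_nonneg_left (Real.exp_le_exp.2 ?_) zero_le_two
            push_cast
            linarith
        _ = _ := by rw [hL, exp_neg_mul_log hm0]
    have hkmR : ((k + 1 : ℕ) : ℝ) ≤ m := by exact_mod_cast hkm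
    have hC : (PR.design m (k + 1)).real {a | ∃ i j, B < |a i j|} ≤
        expMoment 0 * ((m : ℝ) ^ 10)⁻¹ := by
      refine (design_coords_tail hB0).trans ?_
      calc ((k + 1 : ℕ) : ℝ) * (m * (expMoment 0 * Real.exp (-B ^ 2 / 4)))
          ≤ m * (m * (expMoment 0 * ((m : ℝ) ^ 12)⁻¹)) := by gcongr
        _ = _ := by field_simp
    refine (measureReal_mono hsub).trans ((measureReal_union_le _ _).trans ?_)
    linarith
  · have hkmR : (m : ℝ) ≤ k + 1 := by exact_mod_cast hkm.le
    have hKε : K * M ≤ ε := by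
      have h3 : K * (m * M) ≤ K * ((k + 1) * M) :=
        mul_le_mul_of_nonneg_left (mul_le_mul_of_nonneg_right hkmR (by linarith)) hK0
      have h4 : m * (K * M) ≤ m * ε := by linarith
      exact le_of_mul_le_mul_left h4 hmp
    have hsub : badSet q (p + 1) k m ε β ⊆ {a | ∃ i, B < |a i 0|} := by
      intro a ha
      by_contra hc
      simp only [Set.mem_ofPred_eq, not_exists, not_lt] at hc
      obtain ⟨z, hz1, hzS, hz⟩ := exists_unit_of_mem_badSet ha
      have h3 : |(m : ℝ)⁻¹ * ∑ i, a i 0 ^ q * dotp (tl (a i)) z ^ (p + 1)| ≤ M := by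
        refine abs_average_le hm0 fun i => ?_
        rw [abs_mul, abs_pow, abs_pow]
        exact mul_le_mul (pow_le_pow_left₀ (abs_nonneg _) (hc i) q)
          (pow_le_pow_left₀ (abs_nonneg _) (hzS i) _) (by positivity) (by positivity)
      have h4 : |(m : ℝ)⁻¹ * ∑ i, a i 0 ^ q * dotp (tl (a i)) z ^ (p + 1) - μ₀| ≤ M + |μ₀| :=
        (abs_sub _ _).trans (by linarith)
      have h5 : M + |μ₀| ≤ K * M := by
        have : (96 + 2 * |μ₀|) * M ≤ K * M :=
          mul_le_mul_of_nonneg_right (by rw [hK']; linarith) (by linarith)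
        have h6 : |μ₀| ≤ |μ₀| * M := le_mul_of_one_le_right hμa hM1
        linarith
      linarith
    refine (measureReal_mono hsub).trans ((design_head_tail 0 hB0).trans ?_)
    have h11 : (m : ℝ) * (expMoment 0 * ((m : ℝ) ^ 12)⁻¹) ≤ expMoment 0 * ((m : ℝ) ^ 10)⁻¹ := by
      have : (m : ℝ) * (expMoment 0 * ((m : ℝ) ^ 12)⁻¹) = expMoment 0 * ((m : ℝ) ^ 11)⁻¹ := by
        field_simp
      rw [this]
      gcongr
      · linarith
      · norm_num
    have h10 : 0 ≤ ((m : ℝ) ^ 10)⁻¹ := by positivity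
    calc (m : ℝ) * (expMoment 0 * Real.exp (-B ^ 2 / 4))
        ≤ m * (expMoment 0 * ((m : ℝ) ^ 12)⁻¹) := by gcongr
      _ ≤ _ := by linarith

lemma mul_log_le_of_sample_size {K ε : ℝ} {n m : ℝ} (hK : 0 ≤ K) (hn : 1 ≤ n) (hm : 1 ≤ m)
    (hε : 3 / n < ε) (hlog : K * Real.log m ≤ 9 * √m)
    (h : 6 * K * (n * Real.log n / ε ^ 2) ≤ m) : K * (n * Real.log m) ≤ m * ε ^ 2 := by
  have hn0 : 0 < n := by linarith
  have h3 : 0 < 3 / n := by positivity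
  have hε0 : 0 < ε := h3.trans hε
  rcases le_or_gt m (n ^ 6) with hmn | hmn
  · have h1 : Real.log m ≤ 6 * Real.log n := by
      have := Real.log_le_log (by linarith) hmn
      rwa [Real.log_pow] at this
    rw [← mul_div_assoc, div_le_iff₀ (by positivity)] at h
    have : K * (n * Real.log m) ≤ K * (n * (6 * Real.log n)) := by gcongr
    linarith
  · have h1 : n ^ 3 ≤ √m := Real.le_sqrt_of_sq_le (by rw [← pow_mul]; exact hmn.le)
    have h2 : (3 / n) ^ 2 ≤ ε ^ 2 := by gcongr
    have h4 : K * (n * Real.log m) ≤ m * (3 / n) ^ 2 := by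
      rw [div_pow, mul_div_assoc', le_div_iff₀ (by positivity)]
      calc K * (n * Real.log m) * n ^ 2 = K * Real.log m * n ^ 3 := by ring
        _ ≤ 9 * √m * √m := by gcongr
        _ = m * 3 ^ 2 := by rw [mul_assoc, Real.mul_self_sqrt (by linarith)]; ring
    refine h4.trans ?_
    gcongr

lemma measure_badSet_le_of_sample_size (q p k m : ℕ) {K c ε β X : ℝ} {P : Prop} (hm : 3 ≤ m)
    (hε : ε > 3 / ((k : ℝ) + 1)) (hβ : β ≥ 7 * √(Real.log m)) (hK : sampleConst q p ≤ K)
    (hc : 6 * K ≤ c) (hc' : 7 ^ q * K ≤ c) (hlog : K * Real.log m ≤ 9 * √m)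
    (hX : 0 ≤ Real.log m → X = √(Real.log m) ^ q * Real.log m)
    (hP : P → (m : ℝ) ≥ c * max (((k : ℝ) + 1) * Real.log ((k : ℝ) + 1) / ε ^ 2)
      (β ^ (p + 1) * ((k : ℝ) + 1) * X / ε)) :
    (PR.design m (k + 1)).real {a | P ∧ a ∈ badSet q (p + 1) k m ε β} ≤
      (2 + expMoment 0) * ((m : ℝ) ^ 10)⁻¹ := by
  have he0 := expMoment_nonneg 0
  by_cases hp : P
  swap
  · simp only [hp, false_and, Set.ofPred_false, measureReal_empty]
    positivity
  simp only [hp, true_and, Set.ofPred_mem_eq]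
  have hmR : (3 : ℝ) ≤ m := by exact_mod_cast hm
  have hk0 : (0 : ℝ) ≤ k := Nat.cast_nonneg k
  have hε0 : 0 < ε := lt_trans (by positivity) hε
  have hL0 : 0 ≤ Real.log m := Real.log_nonneg (by linarith)
  have hβ0 : 0 ≤ β := le_trans (by positivity) hβ
  have hs0 : 0 ≤ sampleConst q p := by
    have := mul_nonneg (moment_two_mul_nonneg q) (moment_two_mul_nonneg (p + 1))
    have := biasConst_nonneg q (p + 1)
    unfold sampleConst
    positivity
  have hK0 : 0 ≤ K := hs0.trans hK
  have hlogk : 0 ≤ Real.log ((k : ℝ) + 1) := Real.log_nonneg (by linarith)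
  have hXe := hX hL0
  have hmain := hP hp
  have hc0 : 0 ≤ c := le_trans (by positivity) hc
  have h1 : 6 * K * (((k : ℝ) + 1) * Real.log ((k : ℝ) + 1) / ε ^ 2) ≤ m :=
    (mul_le_mul hc (le_max_left _ _) (by positivity) hc0).trans hmain
  have h2 : 7 ^ q * K * (β ^ (p + 1) * ((k : ℝ) + 1) * X / ε) ≤ m :=
    (mul_le_mul hc' (le_max_right _ _) (by rw [hXe]; positivity) hc0).trans hmain
  refine measure_badSet_le q p k m hm hε0 rfl hβ ?_ ?_
  · refine le_trans (mul_le_mul_of_nonneg_right hK (by positivity)) ?_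
    exact mul_log_le_of_sample_size hK0 (by linarith) (by linarith) hε hlog h1
  · refine le_trans (mul_le_mul_of_nonneg_right hK (by positivity)) ?_
    rw [← mul_div_assoc, div_le_iff₀ hε0, hXe] at h2
    refine le_trans (le_of_eq ?_) h2
    rw [mul_pow]
    ring

lemma average_le_of_notMem_badSet {q p k m : ℕ} {ε β : ℝ} {a : Fin m → Fin (k + 1) → ℝ}
    {z : Fin k → ℝ} {P : Prop} (ha : ¬(P ∧ a ∈ badSet q p k m ε β)) (hP : P)
    (hS : ∀ i, |dotp (tl (a i)) z| ≤ β * nrm z) :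
    |(m : ℝ)⁻¹ * ∑ i, a i 0 ^ q * dotp (tl (a i)) z ^ p - moment q * moment p * nrm z ^ p| ≤
      ε * nrm z ^ p := by
  by_contra! h
  exact ha ⟨hP, z, hS, h⟩

lemma moment_two : moment 2 = 1 := by
  simp [moment_add_two 0, moment_zero]

lemma moment_four : moment 4 = 3 := by
  rw [moment_add_two 2, moment_two]; norm_num

lemma moment_six : moment 6 = 15 := by
  rw [moment_add_two 4, moment_four]; norm_num

lemma rpow_five_halves {x : ℝ} (hx : 0 ≤ x) : x ^ ((5 : ℝ) / 2) = √x ^ 3 * x := by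
  rw [show (5 : ℝ) / 2 = 1 / 2 * (3 : ℕ) + 1 by norm_num,
    Real.rpow_add_one' hx (by norm_num), Real.rpow_mul_natCast hx, ← Real.sqrt_eq_rpow]

lemma rpow_three_halves {x : ℝ} (hx : 0 ≤ x) : x ^ ((3 : ℝ) / 2) = √x ^ 1 * x := by
  rw [show (3 : ℝ) / 2 = 1 / 2 + 1 by norm_num,
    Real.rpow_add_one' hx (by norm_num), ← Real.sqrt_eq_rpow, pow_one]

lemma exists_forall_mul_log_le (K : ℝ) :
    ∃ m₀ : ℕ, ∀ m : ℕ, m₀ ≤ m → K * Real.log m ≤ 9 * √(m : ℝ) := by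
  have h := ((isLittleO_log_rpow_atTop (r := 1 / 2) (by norm_num)).const_mul_left K).comp_tendsto
    tendsto_natCast_atTop_atTop
  obtain ⟨m₀, hm₀⟩ := Filter.eventually_atTop.1 (h.bound (by norm_num : (0 : ℝ) < 9))
  refine ⟨m₀, fun m hm => (le_abs_self _).trans ?_⟩
  have := hm₀ m hm
  simp only [Function.comp_apply, Real.norm_eq_abs] at this
  rw [← Real.sqrt_eq_rpow, abs_of_nonneg (Real.sqrt_nonneg _)] at this
  exact this

lemma sampleConst_pos (q p : ℕ) : 0 < sampleConst q p := by
  have := mul_nonneg (moment_two_mul_nonneg q) (moment_two_mul_nonneg (p + 1))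
  have := biasConst_nonneg q (p + 1)
  unfold sampleConst
  positivity

end PR

/-- **Uniform concentration of Gaussian polynomials.** With `n = k + 1`, for every `ε > 3/n`
and every `β ≥ c₁ √(log m)`, with probability `1 − O(m⁻¹⁰)` the six displayed empirical
averages are uniformly close to their means over the incoherent set
`S = {z : maxᵢ |a_{i,⊥}ᵀ z| ≤ β ‖z‖₂}`, under the respective sample-size provisos. -/
theorem gaussian_polynomial_concentration :
    ∃ c₁ > (0 : ℝ), ∃ c₀ > (0 : ℝ), ∃ Cp > (0 : ℝ),
      ∀ (k m : ℕ) (ε β : ℝ),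
        ε > 3 / ((k : ℝ) + 1) → β ≥ c₁ * Real.sqrt (Real.log m) →
        PR.design m (k + 1)
          {a : Fin m → Fin (k + 1) → ℝ |
            ∀ z : Fin k → ℝ, (∀ i, |PR.dotp (PR.tl (a i)) z| ≤ β * PR.nrm z) →
              ((m : ℝ) ≥ c₀ * max (((k : ℝ) + 1) * Real.log ((k : ℝ) + 1) / ε ^ 2)
                  (β * ((k : ℝ) + 1) * Real.log m ^ ((5 : ℝ) / 2) / ε) →
                |(m : ℝ)⁻¹ * ∑ i, a i 0 ^ 3 * PR.dotp (PR.tl (a i)) z| ≤ ε * PR.nrm z) ∧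
              ((m : ℝ) ≥ c₀ * max (((k : ℝ) + 1) * Real.log ((k : ℝ) + 1) / ε ^ 2)
                  (β ^ 3 * ((k : ℝ) + 1) * Real.log m ^ ((3 : ℝ) / 2) / ε) →
                |(m : ℝ)⁻¹ * ∑ i, a i 0 * PR.dotp (PR.tl (a i)) z ^ 3| ≤ ε * PR.nrm z ^ 3) ∧
              ((m : ℝ) ≥ c₀ * max (((k : ℝ) + 1) * Real.log ((k : ℝ) + 1) / ε ^ 2)
                  (β ^ 2 * ((k : ℝ) + 1) * Real.log m ^ 2 / ε) →
                |(m : ℝ)⁻¹ * ∑ i, a i 0 ^ 2 * PR.dotp (PR.tl (a i)) z ^ 2 - PR.nrm z ^ 2| ≤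
                  ε * PR.nrm z ^ 2) ∧
              ((m : ℝ) ≥ c₀ * max (((k : ℝ) + 1) * Real.log ((k : ℝ) + 1) / ε ^ 2)
                  (β ^ 2 * ((k : ℝ) + 1) * Real.log m ^ 4 / ε) →
                |(m : ℝ)⁻¹ * ∑ i, a i 0 ^ 6 * PR.dotp (PR.tl (a i)) z ^ 2 -
                    15 * PR.nrm z ^ 2| ≤ ε * PR.nrm z ^ 2) ∧
              ((m : ℝ) ≥ c₀ * max (((k : ℝ) + 1) * Real.log ((k : ℝ) + 1) / ε ^ 2)
                  (β ^ 6 * ((k : ℝ) + 1) * Real.log m ^ 2 / ε) →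
                |(m : ℝ)⁻¹ * ∑ i, a i 0 ^ 2 * PR.dotp (PR.tl (a i)) z ^ 6 -
                    15 * PR.nrm z ^ 6| ≤ ε * PR.nrm z ^ 6) ∧
              ((m : ℝ) ≥ c₀ * max (((k : ℝ) + 1) * Real.log ((k : ℝ) + 1) / ε ^ 2)
                  (β ^ 4 * ((k : ℝ) + 1) * Real.log m ^ 2 / ε) →
                |(m : ℝ)⁻¹ * ∑ i, a i 0 ^ 2 * PR.dotp (PR.tl (a i)) z ^ 4 -
                    3 * PR.nrm z ^ 4| ≤ ε * PR.nrm z ^ 4)} ≥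
        ENNReal.ofReal (1 - Cp * (m : ℝ) ^ (-10 : ℤ)) := by
  set K : ℝ := PR.sampleConst 3 0 + PR.sampleConst 1 2 + PR.sampleConst 2 1 +
    PR.sampleConst 6 1 + PR.sampleConst 2 5 + PR.sampleConst 2 3 with hK
  have k1 := PR.sampleConst_pos 3 0
  have k2 := PR.sampleConst_pos 1 2
  have k3 := PR.sampleConst_pos 2 1
  have k4 := PR.sampleConst_pos 6 1
  have k5 := PR.sampleConst_pos 2 5
  have k6 := PR.sampleConst_pos 2 3
  have hK0 : 0 < K := by linarith
  obtain ⟨m₁, hm₁⟩ := PR.exists_forall_mul_log_le K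
  have he0 := PR.expMoment_nonneg 0
  refine ⟨7, by norm_num, 7 ^ 6 * K, by positivity,
    6 * (2 + PR.expMoment 0) + ((m₁ + 3 : ℕ) : ℝ) ^ 10, by positivity, ?_⟩
  intro k m ε β hε hβ
  have hk0 : (0 : ℝ) ≤ k := Nat.cast_nonneg k
  have hε0 : 0 < ε := lt_trans (by positivity) hε
  rcases Nat.eq_zero_or_pos m with rfl | hmpos
  · have hmax : ∀ Y : ℝ, ((0 : ℕ) : ℝ) ≥ 7 ^ 6 * K *
        max (((k : ℝ) + 1) * Real.log ((k : ℝ) + 1) / ε ^ 2) Y → k = 0 := by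
      intro Y hY
      by_contra hk
      have hk1 : (0 : ℝ) < k := by exact_mod_cast Nat.pos_of_ne_zero hk
      have hlog : 0 < Real.log ((k : ℝ) + 1) := Real.log_pos (by linarith)
      have h1 : 0 < ((k : ℝ) + 1) * Real.log ((k : ℝ) + 1) / ε ^ 2 := by positivity
      have h2 : 0 < 7 ^ 6 * K *
          max (((k : ℝ) + 1) * Real.log ((k : ℝ) + 1) / ε ^ 2) Y :=
        mul_pos (by positivity) (h1.trans_le (le_max_left _ _))
      rw [Nat.cast_zero] at hY
      linarith
    have hnrm : k = 0 → ∀ z : Fin k → ℝ, PR.nrm z = 0 := by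
      rintro rfl z
      simp [PR.nrm]
    refine le_of_le_of_eq (ENNReal.ofReal_le_one.2 ?_) (Eq.symm ?_)
    · rw [Nat.cast_zero, zero_zpow _ (by norm_num)]
      norm_num
    · rw [← measure_univ (μ := PR.design 0 (k + 1))]
      congr 1
      refine Set.eq_univ_of_forall fun a z _ => ?_
      refine ⟨fun h => ?_, fun h => ?_, fun h => ?_, fun h => ?_, fun h => ?_, fun h => ?_⟩ <;>
      simp [hnrm (hmax _ h) z]
  have hmp : (0 : ℝ) < m := by exact_mod_cast hmpos
  have hzpow : (m : ℝ) ^ (-10 : ℤ) = ((m : ℝ) ^ 10)⁻¹ := by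
    rw [zpow_neg]
    rfl
  rw [hzpow]
  rcases lt_or_ge m (m₁ + 3) with hlt | hge
  · refine le_of_eq_of_le (ENNReal.ofReal_of_nonpos ?_) zero_le
    have h1 : (m : ℝ) ^ 10 ≤ ((m₁ + 3 : ℕ) : ℝ) ^ 10 := by
      gcongr
    have h2 : 1 ≤ ((m₁ + 3 : ℕ) : ℝ) ^ 10 * ((m : ℝ) ^ 10)⁻¹ := by
      rw [← div_eq_mul_inv, one_le_div (by positivity)]
      exact h1
    have h3 : 0 ≤ 6 * (2 + PR.expMoment 0) * ((m : ℝ) ^ 10)⁻¹ := by positivity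
    linarith
  have hm3 : 3 ≤ m := by omega
  have hlog := hm₁ m (by omega)
  have hc : 6 * K ≤ 7 ^ 6 * K := by linarith
  have b1 := PR.measure_badSet_le_of_sample_size 3 0 k m (K := K) (c := 7 ^ 6 * K)
    (X := Real.log m ^ ((5 : ℝ) / 2)) hm3 hε hβ (by linarith) hc (by linarith) hlog
    PR.rpow_five_halves id
  have b2 := PR.measure_badSet_le_of_sample_size 1 2 k m (K := K) (c := 7 ^ 6 * K)
    (X := Real.log m ^ ((3 : ℝ) / 2)) hm3 hε hβ (by linarith) hc (by linarith) hlog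
    PR.rpow_three_halves id
  have b3 := PR.measure_badSet_le_of_sample_size 2 1 k m (K := K) (c := 7 ^ 6 * K)
    (X := Real.log m ^ 2) hm3 hε hβ (by linarith) hc (by linarith) hlog
    (fun h => by rw [Real.sq_sqrt h]; ring) id
  have b4 := PR.measure_badSet_le_of_sample_size 6 1 k m (K := K) (c := 7 ^ 6 * K)
    (X := Real.log m ^ 4) hm3 hε hβ (by linarith) hc (by linarith) hlog
    (fun h => by rw [pow_mul √(Real.log m) 2 3, Real.sq_sqrt h]; ring) id
  have b5 := PR.measure_badSet_le_of_sample_size 2 5 k m (K := K) (c := 7 ^ 6 * K)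
    (X := Real.log m ^ 2) hm3 hε hβ (by linarith) hc (by linarith) hlog
    (fun h => by rw [Real.sq_sqrt h]; ring) id
  have b6 := PR.measure_badSet_le_of_sample_size 2 3 k m (K := K) (c := 7 ^ 6 * K)
    (X := Real.log m ^ 2) hm3 hε hβ (by linarith) hc (by linarith) hlog
    (fun h => by rw [Real.sq_sqrt h]; ring) id
  rw [zero_add, pow_one] at b1
  have bU := (measureReal_union_le _ _).trans (add_le_add b1 <|
    (measureReal_union_le _ _).trans (add_le_add b2 <|
    (measureReal_union_le _ _).trans (add_le_add b3 <|
    (measureReal_union_le _ _).trans (add_le_add b4 <|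
    (measureReal_union_le _ _).trans (add_le_add b5 b6)))))
  refine ge_iff_le.2 (le_trans (ENNReal.ofReal_le_ofReal ?_) (le_of_eq (ofReal_measureReal
    (μ := PR.design m (k + 1)))))
  have huniv : (PR.design m (k + 1)).real Set.univ = 1 := by simp
  have hinv : 0 ≤ ((m₁ + 3 : ℕ) : ℝ) ^ 10 * ((m : ℝ) ^ 10)⁻¹ := by positivity
  suffices hcov : ∀ G W : Set (Fin m → Fin (k + 1) → ℝ),
      (PR.design m (k + 1)).real W ≤ 6 * ((2 + PR.expMoment 0) * ((m : ℝ) ^ 10)⁻¹) →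
      Wᶜ ⊆ G → 1 - (6 * (2 + PR.expMoment 0) + ((m₁ + 3 : ℕ) : ℝ) ^ 10) * ((m : ℝ) ^ 10)⁻¹ ≤
        (PR.design m (k + 1)).real G by
    refine hcov _ _ (bU.trans (by linarith)) fun a ha => ?_
    simp only [Set.mem_compl_iff, Set.mem_union, not_or] at ha
    obtain ⟨a1, a2, a3, a4, a5, a6⟩ := ha
    intro z hz
    refine ⟨fun h => ?_, fun h => ?_, fun h => ?_, fun h => ?_, fun h => ?_, fun h => ?_⟩
    · simpa [PR.moment_one] using PR.average_le_of_notMem_badSet a1 h hz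
    · simpa [PR.moment_one] using PR.average_le_of_notMem_badSet a2 h hz
    · simpa [PR.moment_two] using PR.average_le_of_notMem_badSet a3 h hz
    · simpa [PR.moment_two, PR.moment_six] using PR.average_le_of_notMem_badSet a4 h hz
    · simpa [PR.moment_two, PR.moment_six] using PR.average_le_of_notMem_badSet a5 h hz
    · simpa [PR.moment_two, PR.moment_four] using PR.average_le_of_notMem_badSet a6 h hz
  intro G W hW hWG
  have h1 : (PR.design m (k + 1)).real Set.univ ≤
      (PR.design m (k + 1)).real W + (PR.design m (k + 1)).real G := by
    refine (measureReal_mono ?_).trans (measureReal_union_le W G)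
    intro a _
    by_cases h : a ∈ W
    · exact Or.inl h
    · exact Or.inr (hWG h)
  linarith
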